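/- arXiv:0801.2259 — 3 statements merged into one kernel-verified Lean document; each statement's English description precedes it below -/
import Mathlib

section
/- Let A be a C*-algebra, let d be a lower semicontinuous dimension function on A, let δ > 0, and let a, b be positive elements of M_r(A) with a ≾ b. Then there exists a positive element c ∈ M_r(A) such that b ≾ a ⊕ c and d(c) ≤ d(b) − d(a) + δ. -/
open Filter Topology

noncomputable section

variable {A : Type*}

/-- A positive element of a matrix algebra over a C*-algebra: an element of the form `z* z`. -/
def IsPos [NonUnitalCStarAlgebra A] {ι : Type*} [Fintype ι] (a : Matrix ι ι A) : Prop :=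
  ∃ z : Matrix ι ι A, a = z.conjTranspose * z

/-- Cuntz subequivalence `a ≾ b` of elements of matrix algebras over a C*-algebra. -/
def CuntzLE [NonUnitalCStarAlgebra A] {ι κ : Type*} [Fintype ι] [Fintype κ]
    (a : Matrix ι ι A) (b : Matrix κ κ A) : Prop :=
  ∃ x : ℕ → Matrix ι κ A,
    Tendsto (fun k => x k * b * (x k).conjTranspose) atTop (nhds a)

/-- The block-diagonal direct sum `a ⊕ b` of two square matrices. -/
def dsum [NonUnitalCStarAlgebra A] {ι κ : Type*} (a : Matrix ι ι A) (b : Matrix κ κ A) :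
    Matrix (ι ⊕ κ) (ι ⊕ κ) A :=
  Matrix.fromBlocks a 0 0 b

/-- The block-diagonal direct sum, reindexed so that `Mₙ(A) ⊕ Mₘ(A) ⊆ M_{n+m}(A)`. -/
def dsumF [NonUnitalCStarAlgebra A] {n m : ℕ} (a : Matrix (Fin n) (Fin n) A)
    (b : Matrix (Fin m) (Fin m) A) : Matrix (Fin (n + m)) (Fin (n + m)) A :=
  Matrix.reindex finSumFinEquiv finSumFinEquiv (dsum a b)

/-- A dimension function on a C*-algebra `A`: an additive, order preserving assignment of
nonnegative reals to the positive elements of all matrix algebras over `A`. -/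
structure DimensionFunction (A : Type*) [NonUnitalCStarAlgebra A] where
  d : ∀ n : ℕ, Matrix (Fin n) (Fin n) A → ℝ
  nonneg : ∀ (n : ℕ) (a : Matrix (Fin n) (Fin n) A), IsPos a → 0 ≤ d n a
  add : ∀ (n m : ℕ) (a : Matrix (Fin n) (Fin n) A) (b : Matrix (Fin m) (Fin m) A),
    IsPos a → IsPos b → d (n + m) (dsumF a b) = d n a + d m b
  mono : ∀ (n m : ℕ) (a : Matrix (Fin n) (Fin n) A) (b : Matrix (Fin m) (Fin m) A),
    IsPos a → IsPos b → CuntzLE a b → d n a ≤ d m b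

/-- Lower semicontinuity of a dimension function: `d(aₙ) → d(a)` for every monotone increasing
sequence of positive elements converging in norm to `a`. -/
def DimensionFunction.IsLSC [NonUnitalCStarAlgebra A] (D : DimensionFunction A) : Prop :=
  ∀ (n : ℕ) (s : ℕ → Matrix (Fin n) (Fin n) A) (l : Matrix (Fin n) (Fin n) A),
    (∀ k, IsPos (s k)) → (∀ k, IsPos (s (k + 1) - s k)) →
    Tendsto s atTop (nhds l) →
    Tendsto (fun k => D.d n (s k)) atTop (nhds (D.d n l))

section Abs
variable {B : Type*} [NonUnitalCStarAlgebra B] [PartialOrder B] [StarOrderedRing B]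

lemma spec_nonneg {v : B} (hv : 0 ≤ v) {x : ℝ} (hx : x ∈ quasispectrum ℝ v) : 0 ≤ x :=
  quasispectrum_nonneg_of_nonneg v hv x hx

lemma KA {v : B} (hv : 0 ≤ v) {δ : ℝ} (hδ : 0 < δ) :
    ∃ g f : B, f = g * v ∧ star f = f ∧ ‖v - f * v - v * f + f * v * f‖ ≤ δ := by
  have hsa : IsSelfAdjoint v := .of_nonneg hv
  have hpos : ∀ t : ℝ, t ^ 2 + δ ^ 2 ≠ 0 := fun t => by positivity
  have hg : Continuous (fun t : ℝ => t / (t ^ 2 + δ ^ 2)) := by fun_prop (disch := exact hpos _)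
  have hf : Continuous (fun t : ℝ => t / (t ^ 2 + δ ^ 2) * t) := by fun_prop
  refine ⟨cfcₙ (fun t : ℝ => t / (t ^ 2 + δ ^ 2)) v,
    cfcₙ (fun t : ℝ => t / (t ^ 2 + δ ^ 2) * t) v, ?_, ?_, ?_⟩
  · rw [cfcₙ_mul (fun t : ℝ => t / (t ^ 2 + δ ^ 2)) (fun t => t) v hg.continuousOn (by simp)
      continuousOn_id rfl, cfcₙ_id' ℝ v]
  · exact (cfcₙ_predicate (R := ℝ) (p := IsSelfAdjoint) _ v)
  · set F : ℝ → ℝ := fun t : ℝ => t / (t ^ 2 + δ ^ 2) * t with hF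
    have hF0 : F 0 = 0 := by simp [hF]
    have h1 : cfcₙ F v * v = cfcₙ (fun t => F t * t) v := by
      rw [cfcₙ_mul F (fun t => t) v hf.continuousOn hF0 continuousOn_id rfl, cfcₙ_id' ℝ v]
    have h2 : v * cfcₙ F v = cfcₙ (fun t => t * F t) v := by
      rw [cfcₙ_mul (fun t => t) F v continuousOn_id rfl hf.continuousOn hF0, cfcₙ_id' ℝ v]
    have h3 : cfcₙ F v * v * cfcₙ F v = cfcₙ (fun t => F t * t * F t) v := by
      rw [cfcₙ_mul (fun t => F t * t) F v (hf.mul continuous_id).continuousOn (by simp)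
        hf.continuousOn hF0, h1]
    have h4 : v - cfcₙ F v * v - v * cfcₙ F v + cfcₙ F v * v * cfcₙ F v
        = cfcₙ (fun t => t - F t * t - t * F t + F t * t * F t) v := by
      rw [h3, h1, h2]
      rw [cfcₙ_add (fun t => t - F t * t - t * F t) (fun t => F t * t * F t) v
        (by fun_prop) (by simp) (by fun_prop) (by simp [hF0]),
        cfcₙ_sub (fun t => t - F t * t) (fun t => t * F t) v
        (by fun_prop) (by simp) (by fun_prop) (by simp),
        cfcₙ_sub (fun t => t) (fun t => F t * t) v
        (by fun_prop) (by simp) (by fun_prop) (by simp), cfcₙ_id' ℝ v]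
    rw [h4]
    apply norm_cfcₙ_le
    intro t ht
    have ht0 := spec_nonneg hv ht
    have e : t - F t * t - t * F t + F t * t * F t = t * (δ ^ 2 / (t ^ 2 + δ ^ 2)) ^ 2 := by
      simp only [hF]; field_simp [hpos t]; ring
    rw [e, Real.norm_of_nonneg (by positivity)]
    have a1 : δ ^ 2 / (t ^ 2 + δ ^ 2) ≤ 1 := by
      rw [div_le_one (by positivity)]; nlinarith [sq_nonneg t]
    have a0 : 0 ≤ δ ^ 2 / (t ^ 2 + δ ^ 2) := by positivity
    have a2 : t * (δ ^ 2 / (t ^ 2 + δ ^ 2)) ≤ δ := by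
      rw [← mul_div_assoc, div_le_iff₀ (by positivity)]
      nlinarith [sq_nonneg (t - δ), mul_nonneg hδ.le (sq_nonneg (t - δ)), mul_nonneg ht0 hδ.le,
        mul_nonneg hδ.le (sq_nonneg t), pow_pos hδ 3, mul_nonneg ht0 (sq_nonneg δ)]
    calc t * (δ ^ 2 / (t ^ 2 + δ ^ 2)) ^ 2
        = t * (δ ^ 2 / (t ^ 2 + δ ^ 2)) * (δ ^ 2 / (t ^ 2 + δ ^ 2)) := by ring
      _ ≤ t * (δ ^ 2 / (t ^ 2 + δ ^ 2)) * 1 := by gcongr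
      _ ≤ δ := by linarith

lemma K {s v : B} (hv : 0 ≤ v) {M : ℝ} (hM : 0 ≤ M) (h : star s * s ≤ M • v) :
    ∃ y : ℕ → B, Tendsto (fun k => y k * v) atTop (nhds s) := by
  have key : ∀ k : ℕ, ∃ y : B, ‖y * v - s‖ ^ 2 ≤ M * (1 / ((k : ℝ) + 1)) := by
    intro k
    obtain ⟨g, f, hfg, hf, hn⟩ := KA hv (δ := 1 / ((k : ℝ) + 1)) (by positivity)
    refine ⟨s * g, ?_⟩
    obtain ⟨r, hr⟩ := CStarAlgebra.nonneg_iff_eq_star_mul_self.mp (sub_nonneg.mpr h)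
    have e1 : s * g * v - s = -(s - s * f) := by rw [hfg, mul_assoc]; abel
    rw [e1, norm_neg, sq, ← CStarRing.norm_star_mul_self]
    have e2 : star (s - s * f) * (s - s * f) ≤ M • (v - f * v - v * f + f * v * f) := by
      rw [← sub_nonneg]
      have : M • (v - f * v - v * f + f * v * f) - star (s - s * f) * (s - s * f)
          = star (r - r * f) * (r - r * f) := by
        have : M • (v - f * v - v * f + f * v * f)
          = M • v - f * (M • v) - (M • v) * f + f * (M • v) * f := by
          simp only [smul_add, smul_sub, mul_smul_comm, smul_mul_assoc]
        rw [this]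
        have : M • v = star r * r + star s * s := by rw [← hr]; abel
        rw [this]
        simp only [star_sub, star_mul, hf]
        noncomm_ring
      rw [this]
      exact star_mul_self_nonneg _
    calc _ ≤ ‖M • (v - f * v - v * f + f * v * f)‖ :=
          CStarAlgebra.norm_le_norm_of_nonneg_of_le (star_mul_self_nonneg _) e2
      _ = M * ‖v - f * v - v * f + f * v * f‖ := by rw [norm_smul, Real.norm_of_nonneg hM]
      _ ≤ _ := by gcongr
  choose y hy using key
  refine ⟨y, ?_⟩
  rw [tendsto_iff_norm_sub_tendsto_zero]
  have h0 : Tendsto (fun k : ℕ => M * (1 / ((k : ℝ) + 1))) atTop (nhds 0) := by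
    simpa using tendsto_one_div_add_atTop_nhds_zero_nat.const_mul M
  have := squeeze_zero (fun k => by positivity) hy h0
  have := (Real.continuous_sqrt.tendsto 0).comp this
  simpa [Function.comp_def, Real.sqrt_sq] using this

/-- Cuntz subequivalence inside an algebra -/
def Cu (a b : B) : Prop := ∃ x : ℕ → B, Tendsto (fun k => x k * b * star (x k)) atTop (nhds a)

lemma exists_sqrt {v : B} (hv : 0 ≤ v) : ∃ h : B, 0 ≤ h ∧ h * h = v :=
  ⟨CFC.sqrt v, CFC.sqrt_nonneg v, CFC.sqrt_mul_sqrt_self v hv⟩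

lemma Cu_of_le' {s v : B} (hv : 0 ≤ v) {M : ℝ} (hM : 0 ≤ M) (h : star s * s ≤ M • v) :
    Cu (s * star s) v := by
  obtain ⟨y, hy⟩ := K hv hM h
  obtain ⟨g, hg, hgg⟩ := exists_sqrt hv
  have hgs : star g = g := (IsSelfAdjoint.of_nonneg hg)
  refine ⟨fun k => y k * g, ?_⟩
  refine (hy.mul hy.star).congr fun k => ?_
  simp only [star_mul, hgs, ← hgg]
  simp only [mul_assoc]

lemma Cu_of_le {u v : B} (hu : 0 ≤ u) (hv : 0 ≤ v) {M : ℝ} (hM : 0 ≤ M) (h : u ≤ M • v) :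
    Cu u v := by
  obtain ⟨g, hg, hgg⟩ := exists_sqrt hu
  have hgs : star g = g := (IsSelfAdjoint.of_nonneg hg)
  have := Cu_of_le' (s := g) hv hM (by rwa [hgs, hgg])
  rwa [hgs, hgg] at this

lemma Cu_flip (s : B) : Cu (s * star s) (star s * s) :=
  Cu_of_le' (star_mul_self_nonneg s) zero_le_one (by simp)

lemma Cu_sq {c : B} (hc : 0 ≤ c) : Cu c (c * c) := by
  obtain ⟨g, hg, hgg⟩ := exists_sqrt hc
  have hgs : star g = g := (IsSelfAdjoint.of_nonneg hg)
  have hcs : star c = c := (IsSelfAdjoint.of_nonneg hc)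
  obtain ⟨y, hy⟩ := K (s := g) hc zero_le_one (by simp [hgs, hgg])
  refine ⟨y, ?_⟩
  have := hy.mul hy.star
  rw [hgs, hgg] at this
  refine this.congr fun k => ?_
  simp only [star_mul, hcs, mul_assoc]

/-- the cut-down `(a - θ)₊` -/
def cut (θ : ℝ) (a : B) : B := cfcₙ (fun t : ℝ => max (t - θ) 0) a

lemma cut_cont (θ : ℝ) : Continuous (fun t : ℝ => max (t - θ) 0) := by fun_prop

lemma cut_nonneg (θ : ℝ) (a : B) : 0 ≤ cut θ a := cfcₙ_nonneg fun _ _ => le_max_right _ _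

lemma cut_mono {θ θ' : ℝ} (h0 : 0 ≤ θ) (h : θ ≤ θ') (a : B) : cut θ' a ≤ cut θ a := by
  refine cfcₙ_mono (fun t _ => ?_) (cut_cont _).continuousOn (cut_cont _).continuousOn
    (by simp; linarith) (by simpa using h0)
  exact max_le_max (by linarith) le_rfl

lemma norm_sub_cut {θ : ℝ} (h0 : 0 ≤ θ) {a : B} (ha : 0 ≤ a) : ‖cut θ a - a‖ ≤ θ := by
  have hsa : IsSelfAdjoint a := .of_nonneg ha
  have : cut θ a - a = cfcₙ (fun t : ℝ => max (t - θ) 0 - t) a := by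
    rw [cfcₙ_sub (fun t : ℝ => max (t - θ) 0) (fun t => t) a (cut_cont _).continuousOn
      (by simpa using h0) continuousOn_id rfl, cfcₙ_id' ℝ a]; rfl
  rw [this]
  refine norm_cfcₙ_le fun t ht => ?_
  have := spec_nonneg ha ht
  rw [Real.norm_eq_abs, abs_le]
  rcases max_cases (t - θ) 0 with h | h <;> constructor <;> linarith

lemma cut_tendsto {a : B} (ha : 0 ≤ a) :
    Tendsto (fun k : ℕ => cut (1 / ((k : ℝ) + 1)) a) atTop (nhds a) := by
  rw [tendsto_iff_norm_sub_tendsto_zero]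
  exact squeeze_zero (fun _ => norm_nonneg _) (fun k => norm_sub_cut (by positivity) ha)
    tendsto_one_div_add_atTop_nhds_zero_nat

lemma step1_fun {a : B} (ha : 0 ≤ a) {η : ℝ} (hη : 0 < η) :
    ∃ F h : B, star F = F ∧ star h = h ∧ h * h = a ∧
      cut η a ≤ (h * F) * a * star (h * F) - (η / 2) • ((h * F) * star (h * F)) := by
  have hsa : IsSelfAdjoint a := .of_nonneg ha
  set f : ℝ → ℝ := fun t => √(2 * max (t - η) 0) / max t η with hf
  have hm : ∀ t : ℝ, max t η ≠ 0 := fun t => (lt_of_lt_of_le hη (le_max_right _ _)).ne'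
  have hfc : Continuous f := by
    simp only [hf]
    exact Continuous.div (by fun_prop) (by fun_prop) hm
  have hf0 : f 0 = 0 := by
    have : max (-η) 0 = 0 := max_eq_right (by linarith)
    simp [hf, this]
  have hs0 : √(0:ℝ) = 0 := Real.sqrt_zero
  set P : ℝ → ℝ := fun t => √t * f t with hP
  have hPc : Continuous P := by fun_prop
  have hP0 : P 0 = 0 := by simp [hP]
  have hPP : cfcₙ P a = cfcₙ Real.sqrt a * cfcₙ f a :=
    cfcₙ_mul Real.sqrt f a Real.continuous_sqrt.continuousOn hs0 hfc.continuousOn hf0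
  have hPs : star (cfcₙ P a) = cfcₙ P a := cfcₙ_predicate (R := ℝ) (p := IsSelfAdjoint) _ a
  refine ⟨cfcₙ f a, cfcₙ Real.sqrt a, cfcₙ_predicate (R := ℝ) (p := IsSelfAdjoint) _ a,
    cfcₙ_predicate (R := ℝ) (p := IsSelfAdjoint) _ a, ?_, ?_⟩
  · rw [← cfcₙ_mul Real.sqrt Real.sqrt a Real.continuous_sqrt.continuousOn hs0
      Real.continuous_sqrt.continuousOn hs0]
    conv_rhs => rw [← cfcₙ_id' ℝ a]
    exact cfcₙ_congr fun t ht => Real.mul_self_sqrt (spec_nonneg ha ht)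
  · rw [← hPP, hPs]
    have e1 : cfcₙ P a * a = cfcₙ (fun t => P t * t) a := by
      rw [cfcₙ_mul P (fun t => t) a hPc.continuousOn hP0 continuousOn_id rfl, cfcₙ_id' ℝ a]
    have e2 : cfcₙ P a * a * cfcₙ P a = cfcₙ (fun t => P t * t * P t) a := by
      rw [cfcₙ_mul (fun t => P t * t) P a (by fun_prop) (by simp) hPc.continuousOn hP0, e1]
    have e3 : (η / 2) • (cfcₙ P a * cfcₙ P a) = cfcₙ (fun t => (η / 2) * (P t * P t)) a := by
      rw [cfcₙ_const_mul (η / 2) (fun t => P t * P t) a (by fun_prop) (by simp [hP0]),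
        cfcₙ_mul P P a hPc.continuousOn hP0 hPc.continuousOn hP0]
    rw [e2, e3, ← cfcₙ_sub (fun t => P t * t * P t) (fun t => (η / 2) * (P t * P t)) a
      (by fun_prop) (by simp) (by fun_prop) (by simp [hP0])]
    refine cfcₙ_mono (fun t ht => ?_) (cut_cont _).continuousOn (by fun_prop)
      (by simp; linarith) (by simp [hP0])
    have ht0 := spec_nonneg ha ht
    have hPt : P t * P t = t * (2 * max (t - η) 0) / (max t η) ^ 2 := by
      simp only [hP, hf]
      rw [show √t * (√(2 * max (t - η) 0) / max t η) * (√t * (√(2 * max (t - η) 0) / max t η))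
        = (√t * √t) * (√(2 * max (t - η) 0) * √(2 * max (t - η) 0)) / (max t η) ^ 2 by
          field_simp, Real.mul_self_sqrt ht0, Real.mul_self_sqrt (by positivity)]
    rw [show P t * t * P t - η / 2 * (P t * P t) = (P t * P t) * (t - η / 2) by ring, hPt]
    rcases le_total t η with h | h
    · rw [max_eq_right (by linarith : t - η ≤ 0)]; simp
    · rw [max_eq_left (by linarith : 0 ≤ t - η), max_eq_left h]
      have htp : 0 < t := lt_of_lt_of_le hη h
      rw [show t * (2 * (t - η)) / t ^ 2 * (t - η / 2) = (t - η) * (2 * t - η) / t by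
        field_simp]
      rw [le_div_iff₀ htp]
      nlinarith

lemma step1 {a b : B} (ha : 0 ≤ a) {η : ℝ} (hη : 0 < η) (hab : Cu a b)
    {g : B} (hg : star g = g) (hgg : g * g = b) :
    ∃ S T W : B, S = T * g ∧ Cu (cut η a) (S * star S) ∧ star S * S = W * a * star W := by
  obtain ⟨F, h, hF, hh, hhh, hle⟩ := step1_fun ha hη
  obtain ⟨x, hx⟩ := hab
  obtain ⟨k, hk⟩ := ((tendsto_iff_norm_sub_tendsto_zero.mp hx).eventually
    (gt_mem_nhds (by positivity : (0:ℝ) < η / 2))).exists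
  set m := x k * b * star (x k) with hm
  have hb : star b = b := by rw [← hgg, star_mul, hg]
  have hms : star m = m := by simp [hm, hb, mul_assoc]
  have has : star a = a := (IsSelfAdjoint.of_nonneg ha)
  refine ⟨h * F * x k * g, h * F * x k, g * star (x k) * F, rfl, ?_, ?_⟩
  · refine Cu_of_le (cut_nonneg _ _) (mul_star_self_nonneg _) zero_le_one ?_
    rw [one_smul]
    have e : h * F * x k * g * star (h * F * x k * g) = (h * F) * m * star (h * F) := by
      simp only [hm, ← hgg, star_mul, hg, mul_assoc]
    rw [e]
    refine hle.trans ?_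
    have c1 := CStarAlgebra.star_right_conjugate_le_norm_smul (a := h * F) (b := a - m)
      (by simp [IsSelfAdjoint, has, hms])
    have c2 : ‖a - m‖ • (h * F * star (h * F)) ≤ (η / 2) • (h * F * star (h * F)) := by
      refine smul_le_smul_of_nonneg_right ?_ (mul_star_self_nonneg _)
      rw [norm_sub_rev]; exact hk.le
    have c3 := c1.trans c2
    rw [mul_sub, sub_mul] at c3
    rw [sub_le_comm]
    exact c3
  · simp only [star_mul, hg, hF, hh, star_star, ← hhh, mul_assoc]

lemma step2_fun {a : B} (ha : 0 ≤ a) {θ : ℝ} (hθ : 0 < θ) :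
    ∃ p ψ χ : B, star p = p ∧ p = ψ * a ∧ cut θ a = χ * a ∧ p * cut θ a = cut θ a ∧
      p * p ≤ (1 / θ) • a := by
  have hsa : IsSelfAdjoint a := .of_nonneg ha
  have hm : ∀ t : ℝ, max t θ ≠ 0 := fun t => (lt_of_lt_of_le hθ (le_max_right _ _)).ne'
  set ψ : ℝ → ℝ := fun t => t / (max t θ) ^ 2 with hψ
  set χ : ℝ → ℝ := fun t => max (t - θ) 0 / max t θ with hχ
  have hψc : Continuous ψ := Continuous.div (by fun_prop) (by fun_prop) fun t => pow_ne_zero _ (hm t)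
  have hχc : Continuous χ := Continuous.div (by fun_prop) (by fun_prop) hm
  have hψ0 : ψ 0 = 0 := by simp [hψ]
  have hm0 : max (0 - θ) 0 = 0 := max_eq_right (by linarith)
  have hχ0 : χ 0 = 0 := by simp only [hχ, hm0, zero_div]
  set p : ℝ → ℝ := fun t => ψ t * t with hp
  have hpc : Continuous p := by fun_prop
  have hp0 : p 0 = 0 := by simp [hp]
  refine ⟨cfcₙ p a, cfcₙ ψ a, cfcₙ χ a, cfcₙ_predicate (R := ℝ) (p := IsSelfAdjoint) _ a,
    ?_, ?_, ?_, ?_⟩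
  · rw [cfcₙ_mul ψ (fun t => t) a hψc.continuousOn hψ0 continuousOn_id rfl, cfcₙ_id' ℝ a]
  · have : cfcₙ χ a * a = cfcₙ (fun t => χ t * t) a := by
      rw [cfcₙ_mul χ (fun t => t) a hχc.continuousOn hχ0 continuousOn_id rfl, cfcₙ_id' ℝ a]
    rw [this]
    refine cfcₙ_congr fun t ht => ?_
    simp only [hχ]
    rcases le_total t θ with h | h
    · rw [max_eq_right (by linarith : t - θ ≤ 0)]; simp
    · have htp : 0 < t := lt_of_lt_of_le hθ h
      rw [max_eq_left h]; field_simp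
  · have : cfcₙ p a * cut θ a = cfcₙ (fun t => p t * max (t - θ) 0) a := 
      (cfcₙ_mul p (fun t => max (t - θ) 0) a hpc.continuousOn hp0 (cut_cont _).continuousOn hm0).symm
    rw [this]
    refine cfcₙ_congr fun t ht => ?_
    simp only [hp, hψ]
    rcases le_total t θ with h | h
    · rw [max_eq_right (by linarith : t - θ ≤ 0)]; simp
    · have htp : 0 < t := lt_of_lt_of_le hθ h
      rw [max_eq_left h]; field_simp
  · have e1 : (1 / θ) • a = cfcₙ (fun t => (1 / θ) * t) a := by
      rw [cfcₙ_const_mul_id (1 / θ) a]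
    rw [e1, ← cfcₙ_mul p p a hpc.continuousOn hp0 hpc.continuousOn hp0]
    refine cfcₙ_mono (fun t ht => ?_) (by fun_prop) (by fun_prop) (by simp [hp0]) (by simp)
    have ht0 := spec_nonneg ha ht
    have hM : 0 < max t θ := lt_of_lt_of_le hθ (le_max_right _ _)
    set u := t / max t θ with hu
    have hu0 : 0 ≤ u := by positivity
    have hu1 : u ≤ 1 := by rw [hu, div_le_one hM]; exact le_max_left _ _
    have hut : u ≤ 1 / θ * t := by
      rw [hu, one_div, mul_comm, ← div_eq_mul_inv]
      exact div_le_div_of_nonneg_left ht0 hθ (le_max_right _ _)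
    have hpu : p t = u ^ 2 := by simp only [hp, hψ, hu]; field_simp
    rw [hpu]
    have : u ^ 2 * u ^ 2 ≤ u := by
      have : u ^ 4 ≤ u ^ 1 := pow_le_pow_of_le_one hu0 hu1 (by norm_num)
      nlinarith
    linarith

lemma step2 {b S T g : B} (hg : star g = g) (hgg : g * g = b) (hS : S = T * g)
    {θ : ℝ} (hθ : 0 < θ) :
    ∃ c X Y : B, 0 ≤ c ∧ c = X * g ∧ cut θ (star S * S) = Y * g ∧ c * cut θ (star S * S) = 0 ∧
      Cu b (star S * S + c) := by
  obtain ⟨p, ψ, χ, hp, hpψ, hcut, hpc, hpp⟩ := step2_fun (star_mul_self_nonneg S) hθ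
  have hb : 0 ≤ b := by rw [← hgg]; nth_rw 1 [← hg]; exact star_mul_self_nonneg g
  have hcs : (0 : B) ≤ star (g - g * p) * (g - g * p) := star_mul_self_nonneg _
  refine ⟨star (g - g * p) * (g - g * p),
    star (g - g * p) - star (g - g * p) * g * (ψ * star S * T), χ * star S * T,
    star_mul_self_nonneg _, ?_, ?_, ?_, ?_⟩
  · rw [sub_mul, mul_sub]
    congr 1
    rw [← mul_assoc, mul_assoc _ _ g]
    congr 1
    rw [hpψ]; nth_rw 2 [hS]; simp only [mul_assoc]
  · rw [hcut]; nth_rw 2 [hS]; simp only [mul_assoc]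
  · rw [mul_assoc, sub_mul, mul_assoc, hpc, sub_self, mul_zero]
  · set c := star (g - g * p) * (g - g * p) with hc
    have hD : 0 ≤ star S * S + c := add_nonneg (star_mul_self_nonneg _) hcs
    have hMθ : 0 ≤ 2 * ‖b‖ / θ := by positivity
    refine Cu_of_le hb hD (M := 2 + 2 * ‖b‖ / θ) (by positivity) ?_
    have h1 : b ≤ (2 : ℝ) • c + (2 : ℝ) • (p * b * p) := by
      rw [← sub_nonneg]
      have : (2 : ℝ) • c + (2 : ℝ) • (p * b * p) - b
          = star (g - g * p - g * p) * (g - g * p - g * p) := by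
        simp only [hc, ← hgg, two_smul, star_sub, star_mul, hg, hp]
        noncomm_ring
      rw [this]; exact star_mul_self_nonneg _
    have h2 : p * b * p ≤ ‖b‖ • (p * p) := by
      have := CStarAlgebra.star_left_conjugate_le_norm_smul (a := p) (b := b) (.of_nonneg hb)
      rwa [hp] at this
    have h3 : ‖b‖ • (p * p) ≤ ‖b‖ • ((1 / θ) • (star S * S)) :=
      smul_le_smul_of_nonneg_left hpp (norm_nonneg _)
    have h4 : (2 : ℝ) • (p * b * p) ≤ (2 : ℝ) • (‖b‖ • ((1 / θ) • (star S * S))) :=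
      smul_le_smul_of_nonneg_left (h2.trans h3) (by norm_num)
    calc b ≤ (2 : ℝ) • c + (2 : ℝ) • (p * b * p) := h1
      _ ≤ (2 : ℝ) • c + (2 : ℝ) • (‖b‖ • ((1 / θ) • (star S * S))) := by gcongr
      _ = (2 : ℝ) • c + (2 * ‖b‖ / θ) • (star S * S) := by
        rw [smul_smul, smul_smul]; congr 2; ring
      _ ≤ (2 + 2 * ‖b‖ / θ) • c + (2 + 2 * ‖b‖ / θ) • (star S * S) := by
        refine add_le_add (smul_le_smul_of_nonneg_right (by linarith) hcs)
          (smul_le_smul_of_nonneg_right (by linarith) (star_mul_self_nonneg _))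
      _ = _ := by rw [← smul_add, add_comm c]

end Abs

lemma nn_iff {B : Type*} [NonUnitalCStarAlgebra B] [PartialOrder B] [StarOrderedRing B] (a : B) :
    0 ≤ a ↔ ∃ z : B, a = star z * z := CStarAlgebra.nonneg_iff_eq_star_mul_self

section Transfer
variable [NonUnitalCStarAlgebra A] [PartialOrder A] [StarOrderedRing A]

/-- the matrix algebra as a C*-algebra -/
abbrev Mx (r : ℕ) (A : Type*) := CStarMatrix (Fin r) (Fin r) A

lemma isPos_iff {r : ℕ} (a : Mx r A) :
    IsPos (ι := Fin r) (A := A) a ↔ 0 ≤ a := by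
  exact (nn_iff a).symm

lemma cuntz_iff {r : ℕ} (a b : Mx r A) :
    CuntzLE (ι := Fin r) (κ := Fin r) (A := A) a b ↔ Cu a b := Iff.rfl

lemma dsumF_pos {r : ℕ} {a b : Matrix (Fin r) (Fin r) A} (ha : IsPos a) (hb : IsPos b) :
    IsPos (dsumF a b) := by
  obtain ⟨z, rfl⟩ := ha
  obtain ⟨w, rfl⟩ := hb
  refine ⟨dsumF z w, ?_⟩
  simp only [dsumF, dsum, Matrix.reindex_apply, Matrix.conjTranspose_submatrix,
    Matrix.submatrix_mul_equiv, Matrix.fromBlocks_conjTranspose, Matrix.fromBlocks_multiply]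
  simp

lemma cuntz_row {r : ℕ} {b a c : Matrix (Fin r) (Fin r) A} {x y : ℕ → Matrix (Fin r) (Fin r) A}
    (h : Tendsto (fun k => x k * a * (x k).conjTranspose + y k * c * (y k).conjTranspose) atTop
      (nhds b)) : CuntzLE b (dsumF a c) := by
  refine ⟨fun k => (Matrix.fromCols (x k) (y k)).submatrix id finSumFinEquiv.symm, ?_⟩
  refine h.congr fun k => ?_
  simp only [dsumF, dsum, Matrix.reindex_apply, Matrix.conjTranspose_submatrix,
    Matrix.submatrix_mul_equiv,
    Matrix.conjTranspose_fromCols_eq_fromRows_conjTranspose]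
  ext i j
  simp [Matrix.mul_apply, Fintype.sum_sum_type]

lemma rows_mul_cols {r : ℕ} (X Y b Z W : Matrix (Fin r) (Fin r) A) :
    Matrix.fromRows X Y * b * Matrix.fromCols Z W
      = Matrix.fromBlocks (X * b * Z) (X * b * W) (Y * b * Z) (Y * b * W) := by
  ext (i | i) (j | j) <;> simp [Matrix.mul_apply]

lemma cuntz_col {r : ℕ} {b c t g X Y : Matrix (Fin r) (Fin r) A}
    (hg : g.conjTranspose = g) (hgg : g * g = b) (hc : c.conjTranspose = c)
    (ht : t.conjTranspose = t) (hX : c = X * g) (hY : t = Y * g) (hct : c * t = 0) :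
    CuntzLE (dsumF (c * c) (t * t)) b := by
  refine ⟨fun _ => (Matrix.fromRows X Y).submatrix finSumFinEquiv.symm id, ?_⟩
  have htc : t * c = 0 := by
    have := congrArg Matrix.conjTranspose hct
    simpa [Matrix.conjTranspose_mul, hc, ht] using this
  have e : ∀ P Q : Matrix (Fin r) (Fin r) A, P * b * Q.conjTranspose
      = (P * g) * (Q * g).conjTranspose := by
    intro P Q
    rw [Matrix.conjTranspose_mul, hg, ← hgg]; simp only [Matrix.mul_assoc]
  have : (Matrix.fromRows X Y).submatrix finSumFinEquiv.symm id * b *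
      ((Matrix.fromRows X Y).submatrix finSumFinEquiv.symm id).conjTranspose
      = dsumF (c * c) (t * t) := by
    have hb : b = b.submatrix id id := by simp
    rw [hb]
    simp only [dsumF, dsum, Matrix.reindex_apply, Matrix.conjTranspose_submatrix,
      Matrix.conjTranspose_fromRows_eq_fromCols_conjTranspose]
    rw [← Matrix.submatrix_mul _ _ _ _ _ Function.bijective_id,
      ← Matrix.submatrix_mul _ _ _ _ _ Function.bijective_id,
      rows_mul_cols, e, e, e, e,
      ← hX, ← hY, hc, ht, hct, htc]
  simp only [this]
  exact tendsto_const_nhds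

lemma lsc_cut (D : DimensionFunction A) (hD : D.IsLSC) {δ : ℝ} (hδ : 0 < δ)
    {r : ℕ} (a : Mx r A) (ha : 0 ≤ a) :
    ∃ η : ℝ, 0 < η ∧ D.d r a - δ < D.d r (cut η a : Mx r A) := by
  have hmono : ∀ k : ℕ, 0 ≤ (cut (1 / (((k + 1 : ℕ) : ℝ) + 1)) a - cut (1 / ((k : ℝ) + 1)) a : Mx r A) := by
    intro k
    refine sub_nonneg.mpr (cut_mono (by positivity) ?_ a)
    push_cast
    exact one_div_le_one_div_of_le (by positivity) (by linarith)
  have := hD r (fun k => (cut (1 / ((k : ℝ) + 1)) a : Mx r A)) a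
    (fun k => (isPos_iff _).mpr (cut_nonneg _ _))
    (fun k => (isPos_iff _).mpr (hmono k))
    (cut_tendsto (B := Mx r A) ha)
  obtain ⟨k, hk⟩ := (this.eventually (lt_mem_nhds (sub_lt_self _ hδ))).exists
  exact ⟨1 / ((k : ℝ) + 1), by positivity, hk⟩

lemma main_aux (D : DimensionFunction A) (hD : D.IsLSC) (δ : ℝ) (hδ : 0 < δ)
    {r : ℕ} (a b : Mx r A) (ha : 0 ≤ a) (hb : 0 ≤ b) (hab : Cu a b) :
    ∃ c : Mx r A, 0 ≤ c ∧ CuntzLE (A := A) (ι := Fin r) b (dsumF (A := A) (n := r) (m := r) a c) ∧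
      D.d r c ≤ D.d r b - D.d r a + δ := by
  have mono : ∀ u v : Mx r A, 0 ≤ u → 0 ≤ v → Cu u v → D.d r u ≤ D.d r v := fun u v hu hv h =>
    D.mono r r u v ((isPos_iff _).mpr hu) ((isPos_iff _).mpr hv) h
  obtain ⟨g, hg0, hgg⟩ := exists_sqrt hb
  have hg : star g = g := IsSelfAdjoint.of_nonneg hg0
  obtain ⟨η, hη, hdη⟩ := lsc_cut D hD (half_pos hδ) a ha
  obtain ⟨S, T, W, hS, hcu, hW⟩ := step1 ha hη hab hg hgg
  have m1 := mono _ _ (cut_nonneg η a) (mul_star_self_nonneg S) hcu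
  have m2 := mono _ _ (mul_star_self_nonneg S) (star_mul_self_nonneg S) (Cu_flip S)
  obtain ⟨θ, hθ, hdθ⟩ := lsc_cut D hD (half_pos hδ) (star S * S) (star_mul_self_nonneg S)
  obtain ⟨c, X, Y, hc, hX, hY, hct, hbc⟩ := step2 hg hgg hS hθ
  have htn := cut_nonneg θ (star S * S)
  set t := cut θ (star S * S) with ht
  have hcs : star c = c := IsSelfAdjoint.of_nonneg hc
  have hts : star t = t := IsSelfAdjoint.of_nonneg htn
  have hcc : 0 ≤ c * c := by nth_rw 1 [← hcs]; exact star_mul_self_nonneg c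
  have htt : 0 ≤ t * t := by nth_rw 1 [← hts]; exact star_mul_self_nonneg t
  refine ⟨c, hc, ?_, ?_⟩
  · obtain ⟨x, hx⟩ := hbc
    refine cuntz_row (x := fun k => (x k * W : Mx r A)) (y := x) (hx.congr fun k => ?_)
    rw [hW]
    change _ = (x k * W) * a * star (x k * W) + x k * c * star (x k)
    simp only [star_mul, mul_add, add_mul, mul_assoc]
  · have m3 := mono _ _ hc hcc (Cu_sq hc)
    have m4 := mono _ _ htn htt (Cu_sq htn)
    have p1 := (isPos_iff _).mpr hcc
    have p2 := (isPos_iff _).mpr htt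
    have hadd := D.add r r (c * c : Mx r A) (t * t : Mx r A) p1 p2
    have hcol := D.mono (r + r) r _ b (dsumF_pos p1 p2) ((isPos_iff _).mpr hb)
      (cuntz_col (A := A) (b := b) (c := c) (t := t) (g := g) (X := X) (Y := Y)
        hg hgg hcs hts hX hY hct)
    have hcol' : D.d (r + r) (dsumF (A := A) (n := r) (m := r) (c * c : Mx r A) (t * t : Mx r A))
      ≤ D.d r b := hcol
    linarith

end Transfer

/-- If `a ≾ b` are positive in `M_r(A)`, `d` is a lower semicontinuous dimension function and
`δ > 0`, then there is a positive `c ∈ M_r(A)` with `b ≾ a ⊕ c` and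
`d(c) ≤ d(b) - d(a) + δ`. -/
theorem exists_almost_algebraic_complement [NonUnitalCStarAlgebra A]
    (D : DimensionFunction A) (hD : D.IsLSC) (δ : ℝ) (hδ : 0 < δ)
    {r : ℕ} (a b : Matrix (Fin r) (Fin r) A) (ha : IsPos a) (hb : IsPos b)
    (hab : CuntzLE a b) :
    ∃ c : Matrix (Fin r) (Fin r) A, IsPos c ∧ CuntzLE b (dsumF a c) ∧
      D.d r c ≤ D.d r b - D.d r a + δ := by
  letI : PartialOrder A := CStarAlgebra.spectralOrder A
  haveI : StarOrderedRing A := CStarAlgebra.spectralOrderedRing A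
  obtain ⟨c, hc, h1, h2⟩ := main_aux D hD δ hδ (r := r) a b ((isPos_iff (r := r) a).mp ha)
    ((isPos_iff (r := r) b).mp hb) hab
  exact ⟨c, (isPos_iff (r := r) c).mpr hc, h1, h2⟩
end
end

section
/- Let p, q ≥ 1 be natural numbers. The dimension-drop algebra Z_{p,q} has no projections other than 0 and 1 if and only if p and q are relatively prime. -/
open scoped Kronecker

noncomputable section

lemma star_kronecker {p q : ℕ} (x : Matrix (Fin p) (Fin p) ℂ) (y : Matrix (Fin q) (Fin q) ℂ) :
    star (x ⊗ₖ y) = (star x) ⊗ₖ (star y) := by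
  ext ⟨i, k⟩ ⟨j, l⟩
  simp [Matrix.star_apply, Matrix.kroneckerMap_apply, star_mul', mul_comm]

/-- The dimension-drop algebra `Z_{p,q}`: continuous functions from `[0,1]` to
`M_p ⊗ M_q = M_{pq}` whose value at `0` lies in `M_p ⊗ ℂ1` and whose value at `1` lies in
`ℂ1 ⊗ M_q`. -/
def DimDrop (p q : ℕ) :
    StarSubalgebra ℂ C(unitInterval, Matrix (Fin p × Fin q) (Fin p × Fin q) ℂ) where
  carrier := {f | (∃ x : Matrix (Fin p) (Fin p) ℂ, f 0 = x ⊗ₖ (1 : Matrix (Fin q) (Fin q) ℂ)) ∧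
      (∃ y : Matrix (Fin q) (Fin q) ℂ, f 1 = (1 : Matrix (Fin p) (Fin p) ℂ) ⊗ₖ y)}
  mul_mem' := by
    rintro f g ⟨⟨x, hx⟩, ⟨y, hy⟩⟩ ⟨⟨x', hx'⟩, ⟨y', hy'⟩⟩
    refine ⟨⟨x * x', ?_⟩, ⟨y * y', ?_⟩⟩
    · rw [ContinuousMap.mul_apply, hx, hx', ← Matrix.mul_kronecker_mul, one_mul]
    · rw [ContinuousMap.mul_apply, hy, hy', ← Matrix.mul_kronecker_mul, one_mul]
  add_mem' := by
    rintro f g ⟨⟨x, hx⟩, ⟨y, hy⟩⟩ ⟨⟨x', hx'⟩, ⟨y', hy'⟩⟩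
    refine ⟨⟨x + x', ?_⟩, ⟨y + y', ?_⟩⟩
    · rw [ContinuousMap.add_apply, hx, hx', Matrix.add_kronecker]
    · rw [ContinuousMap.add_apply, hy, hy', Matrix.kronecker_add]
  algebraMap_mem' := fun c =>
    ⟨⟨c • 1, by rw [Algebra.algebraMap_eq_smul_one, ContinuousMap.smul_apply,
        ContinuousMap.one_apply, Matrix.smul_kronecker, Matrix.one_kronecker_one]⟩,
     ⟨c • 1, by rw [Algebra.algebraMap_eq_smul_one, ContinuousMap.smul_apply,
        ContinuousMap.one_apply, Matrix.kronecker_smul, Matrix.one_kronecker_one]⟩⟩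
  star_mem' := by
    rintro f ⟨⟨x, hx⟩, ⟨y, hy⟩⟩
    refine ⟨⟨star x, ?_⟩, ⟨star y, ?_⟩⟩
    · rw [ContinuousMap.star_apply, hx, star_kronecker, star_one]
    · rw [ContinuousMap.star_apply, hy, star_kronecker, star_one]

lemma idem_trace {n : Type*} [Fintype n] [DecidableEq n] (A : Matrix n n ℂ) (h : A * A = A) :
    ∃ k : ℕ, k ≤ Fintype.card n ∧ A.trace = k := by
  have hi : IsIdempotentElem (Matrix.toLin' A) := by
    unfold IsIdempotentElem
    rw [Module.End.mul_eq_comp, ← Matrix.toLin'_mul, h]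
  have hproj := LinearMap.IsIdempotentElem.isProj_range _ hi
  refine ⟨Module.finrank ℂ (LinearMap.range (Matrix.toLin' A)), ?_, ?_⟩
  · simpa using Submodule.finrank_le (LinearMap.range (Matrix.toLin' A))
  · rw [← hproj.trace, Matrix.trace_toLin'_eq]

open scoped ComplexOrder in
lemma proj_eq_zero {n : Type*} [Fintype n] [DecidableEq n] (A : Matrix n n ℂ) (h : A * A = A)
    (hs : star A = A) (ht : A.trace = 0) : A = 0 := by
  rw [← Matrix.trace_conjTranspose_mul_self_eq_zero_iff, ← Matrix.star_eq_conjTranspose, hs, h, ht]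

lemma trivial_of_coprime (p q : ℕ) (hp : 1 ≤ p) (hq : 1 ≤ q) (hpq : Nat.Coprime p q)
    (e : DimDrop p q) (hs : star e = e) (he : e * e = e) : e = 0 ∨ e = 1 := by
  obtain ⟨f, ⟨x, hx⟩, ⟨y, hy⟩⟩ := e
  have hs' : star f = f := congrArg Subtype.val hs
  have he' : f * f = f := congrArg Subtype.val he
  have hst : ∀ t, star (f t) = f t := fun t => by
    rw [← ContinuousMap.star_apply, hs']
  have het : ∀ t, f t * f t = f t := fun t => by
    rw [← ContinuousMap.mul_apply, he']
  choose k hk htr using fun t => idem_trace (f t) (het t)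
  have hcont : Continuous k := by
    rw [Nat.isClosedEmbedding_coe_real.isInducing.continuous_iff]
    have : ((↑) : ℕ → ℝ) ∘ k = fun t => (Matrix.trace (f t)).re := by
      funext t
      simp [htr]
    rw [this]
    exact Complex.continuous_re.comp (Continuous.matrix_trace f.continuous)
  have hconst : ∀ t, k t = k 0 := fun t => PreconnectedSpace.constant inferInstance hcont
  have : NeZero p := ⟨by omega⟩
  have : NeZero q := ⟨by omega⟩
  have hxx : x * x = x := by
    have h := het 0
    rw [hx, ← Matrix.mul_kronecker_mul, one_mul] at h
    ext i j
    have := congrFun (congrFun h (i, 0)) (j, 0)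
    simpa using this
  have hyy : y * y = y := by
    have h := het 1
    rw [hy, ← Matrix.mul_kronecker_mul, one_mul] at h
    ext i j
    have := congrFun (congrFun h (0, i)) (0, j)
    simpa using this
  obtain ⟨a, ha, hxa⟩ := idem_trace x hxx
  obtain ⟨b, hb, hyb⟩ := idem_trace y hyy
  have h0 : k 0 = a * q := by
    have h := htr 0
    rw [hx, Matrix.trace_kronecker, hxa, Matrix.trace_one, Fintype.card_fin] at h
    exact_mod_cast h.symm
  have h1 : k 0 = p * b := by
    have h := htr 1
    rw [hy, Matrix.trace_kronecker, hyb, Matrix.trace_one, Fintype.card_fin, hconst 1] at h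
    exact_mod_cast h.symm
  have hdvd : p ∣ a := hpq.dvd_of_dvd_mul_right ⟨b, h0.symm.trans h1⟩
  rw [Fintype.card_fin] at ha
  rcases Nat.eq_zero_or_pos a with rfl | hapos
  · left
    apply Subtype.ext
    change f = 0
    ext1 t
    exact proj_eq_zero _ (het t) (hst t) (by rw [htr, hconst, h0]; simp)
  · right
    have hap : a = p := le_antisymm ha (Nat.le_of_dvd hapos hdvd)
    apply Subtype.ext
    change f = 1
    ext1 t
    have : 1 - f t = 0 := by
      apply proj_eq_zero
      · rw [mul_sub, sub_mul, sub_mul, het t]; simp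
      · rw [star_sub, star_one, hst]
      · rw [Matrix.trace_sub, htr, hconst, h0, hap, Matrix.trace_one]; simp
    exact (sub_eq_zero.mp this).symm

lemma exists_path {n : Type*} [Fintype n] [DecidableEq n] (E W : Matrix n n ℂ)
    (hE : E * E = E) (hEs : star E = E) (hW : W * W = 1) (hWs : star W = W) :
    ∃ f : C(unitInterval, Matrix n n ℂ), star f = f ∧ f * f = f ∧ f 0 = E ∧
      f 1 = W * E * W := by
  let z : unitInterval → ℂ := fun t => Complex.exp ((Real.pi * (t : ℝ) : ℝ) * Complex.I)
  have hz : ∀ t, star (z t) * z t = 1 := fun t => by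
    simp only [z, Complex.star_def]
    rw [← Complex.exp_conj, ← Complex.exp_add]
    simp
  have hzc : Continuous z := by fun_prop
  let U : unitInterval → Matrix n n ℂ := fun t =>
    (1 / 2 : ℂ) • (1 + W) + (z t / 2) • (1 - W)
  have hU : ∀ t, star (U t) * U t = 1 := fun t => by
    have h1 : (1 + W) * (1 + W) = (2 : ℂ) • (1 + W) := by
      rw [add_mul, mul_add, mul_add, hW, two_smul]; simp; abel
    have h2 : (1 + W) * (1 - W) = 0 := by
      rw [add_mul, mul_sub, mul_sub, hW]; simp
    have h3 : (1 - W) * (1 + W) = 0 := by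
      rw [sub_mul, mul_add, mul_add, hW]; simp; abel
    have h4 : (1 - W) * (1 - W) = (2 : ℂ) • (1 - W) := by
      rw [sub_mul, mul_sub, mul_sub, hW, two_smul]; simp; abel
    have hst : star (U t) = (1 / 2 : ℂ) • (1 + W) + (star (z t) / 2) • (1 - W) := by
      simp [U, star_add, star_smul, hWs, star_sub]
    rw [hst]
    simp only [U, add_mul, mul_add (_ • _), smul_mul_smul_comm, h1, h2, h3, h4, smul_zero, smul_smul]
    have : star (z t) / 2 * (z t / 2) * 2 = 1 / 2 := by
      linear_combination (1 / 2 : ℂ) * hz t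
    rw [this]
    ext i j
    simp
    ring
  have hUc : Continuous U := by
    simp only [U]
    fun_prop
  refine ⟨⟨fun t => U t * E * star (U t), ?_⟩, ?_, ?_, ?_, ?_⟩
  · exact (hUc.matrix_mul continuous_const).matrix_mul hUc.star
  · ext1 t
    simp [hEs, mul_assoc]
  · ext1 t
    change U t * E * star (U t) * (U t * E * star (U t)) = U t * E * star (U t)
    calc _ = U t * E * (star (U t) * U t) * E * star (U t) := by simp only [mul_assoc]
      _ = U t * (E * E) * star (U t) := by rw [hU]; simp only [mul_assoc, mul_one, one_mul]
      _ = _ := by rw [hE]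
  · have : U 0 = 1 := by
      simp only [U, z]
      ext i j
      simp
      ring
    simp [this]
  · have : U 1 = W := by
      simp only [U, z]
      ext i j
      simp
      ring
    simp [this, hWs]

/-- The flip of the two `Fin d` tensor factors. -/
def flipEquiv (d a b : ℕ) : Fin (d * a) × Fin (d * b) → Fin (d * a) × Fin (d * b) := fun x =>
  (finProdFinEquiv ((finProdFinEquiv.symm x.2).1, (finProdFinEquiv.symm x.1).2),
   finProdFinEquiv ((finProdFinEquiv.symm x.1).1, (finProdFinEquiv.symm x.2).2))

lemma flipEquiv_flipEquiv (d a b : ℕ) (x : Fin (d * a) × Fin (d * b)) :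
    flipEquiv d a b (flipEquiv d a b x) = x := by
  simp only [flipEquiv, Equiv.symm_apply_apply, Prod.mk.eta, Equiv.apply_symm_apply]

lemma coprime_of_trivial (p q : ℕ) (hp : 1 ≤ p) (hq : 1 ≤ q)
    (H : ∀ e : DimDrop p q, star e = e → e * e = e → e = 0 ∨ e = 1) : Nat.Coprime p q := by
  by_contra hc
  obtain ⟨d, hd, ⟨a, rfl⟩, ⟨b, rfl⟩⟩ : ∃ d, 2 ≤ d ∧ d ∣ p ∧ d ∣ q :=
    ⟨Nat.gcd p q, by
      have : 0 < Nat.gcd p q := Nat.gcd_pos_of_pos_left _ hp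
      have : Nat.gcd p q ≠ 1 := hc
      omega, Nat.gcd_dvd_left _ _, Nat.gcd_dvd_right _ _⟩
  have ha : 0 < a := Nat.pos_of_mul_pos_left hp
  have hb : 0 < b := Nat.pos_of_mul_pos_left hq
  let i0 : Fin d := ⟨0, by omega⟩
  let i1 : Fin d := ⟨1, by omega⟩
  let u : (c : ℕ) → Fin (d * c) → ℂ := fun c i =>
    if (finProdFinEquiv.symm i).1 = i0 then 1 else 0
  have huf : ∀ c i j, u c (finProdFinEquiv (i, j)) = if i = i0 then 1 else 0 := fun c i j => by
    simp only [u, Equiv.symm_apply_apply]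
  have huu : ∀ c i, u c i * u c i = u c i := fun c i => by simp only [u]; split_ifs <;> simp
  have hus : ∀ c i, star (u c i) = u c i := fun c i => by simp only [u]; split_ifs <;> simp
  let σ : Equiv.Perm (Fin (d * a) × Fin (d * b)) :=
    ⟨flipEquiv d a b, flipEquiv d a b, flipEquiv_flipEquiv d a b, flipEquiv_flipEquiv d a b⟩
  have hσσ : ∀ x, σ (σ x) = x := flipEquiv_flipEquiv d a b
  let W : Matrix (Fin (d * a) × Fin (d * b)) (Fin (d * a) × Fin (d * b)) ℂ :=
    (1 : Matrix _ _ ℂ).submatrix σ id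
  let E : Matrix (Fin (d * a) × Fin (d * b)) (Fin (d * a) × Fin (d * b)) ℂ :=
    Matrix.diagonal fun x => u a x.1
  have hWl : ∀ M : Matrix (Fin (d * a) × Fin (d * b)) (Fin (d * a) × Fin (d * b)) ℂ,
      W * M = M.submatrix σ id := fun M => by
    ext x y
    simp [W, Matrix.mul_apply, Matrix.one_apply]
  have hW : W * W = 1 := by
    rw [hWl]
    ext x y
    change (1 : Matrix (Fin (d * a) × Fin (d * b)) (Fin (d * a) × Fin (d * b)) ℂ) (σ (σ x)) y = _
    rw [hσσ]
  have hWs : star W = W := by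
    ext x y
    have : σ y = x ↔ σ x = y := by
      constructor <;> (rintro rfl; exact hσσ _)
    simp [W, Matrix.one_apply, Matrix.star_apply, this, apply_ite]
  have hWEW : W * E * W = Matrix.diagonal fun x => u b x.2 := by
    rw [mul_assoc, hWl]
    ext x y
    simp only [E, W, Matrix.diagonal_mul, Matrix.submatrix_apply, hσσ, id, Matrix.one_apply,
      Matrix.diagonal_apply]
    have : u a (σ x).1 = u b x.2 := by
      simp only [σ, flipEquiv, Equiv.coe_fn_mk, huf]
      rfl
    rw [this]; simp
  obtain ⟨f, hfs, hff, hf0, hf1⟩ := exists_path E W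
    (by simp [E, Matrix.diagonal_mul_diagonal, huu])
    (by
      rw [Matrix.star_eq_conjTranspose, Matrix.diagonal_conjTranspose]
      congr 1
      funext x
      exact hus a x.1) hW hWs
  have hmem : f ∈ DimDrop (d * a) (d * b) := by
    refine ⟨⟨Matrix.diagonal (u a), ?_⟩, ⟨Matrix.diagonal (u b), ?_⟩⟩
    · rw [hf0, ← Matrix.diagonal_one, Matrix.diagonal_kronecker_diagonal]
      simp [E]
    · rw [hf1, hWEW, ← Matrix.diagonal_one, Matrix.diagonal_kronecker_diagonal]
      simp
  rcases H ⟨f, hmem⟩ (Subtype.ext hfs) (Subtype.ext hff) with h | h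
  · have h' : f = 0 := congrArg Subtype.val h
    let x : Fin (d * a) × Fin (d * b) :=
      (finProdFinEquiv (i0, ⟨0, ha⟩), finProdFinEquiv (i0, ⟨0, hb⟩))
    rw [h'] at hf0
    have := congrFun (congrFun hf0 x) x
    simp [E, x, huf] at this
  · have h' : f = 1 := congrArg Subtype.val h
    let x : Fin (d * a) × Fin (d * b) :=
      (finProdFinEquiv (i1, ⟨0, ha⟩), finProdFinEquiv (i0, ⟨0, hb⟩))
    rw [h'] at hf0
    have := congrFun (congrFun hf0 x) x
    simp [E, x, huf, i0, i1] at this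

/-- The dimension-drop algebra `Z_{p,q}` has no projections other than `0` and `1`
if and only if `p` and `q` are relatively prime. -/
theorem dimDrop_trivial_projections_iff_coprime (p q : ℕ) (hp : 1 ≤ p) (hq : 1 ≤ q) :
    (∀ e : DimDrop p q, star e = e → e * e = e → e = 0 ∨ e = 1) ↔ Nat.Coprime p q := by
  exact ⟨coprime_of_trivial p q hp hq, fun h e => trivial_of_coprime p q hp hq h e⟩
end
end

section
/- Let p, q ≥ 2 be relatively prime natural numbers and let I be a closed two-sided ideal of the dimension-drop algebra Z_{p,q} with I ≠ 0 and I ≠ Z_{p,q}. Then the quotient C*-algebra Z_{p,q}/I contains a projection different from 0 and 1. -/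
open scoped Kronecker

noncomputable section

lemma dimDrop_sum_mem {p q : ℕ} (I : TwoSidedIdeal (DimDrop p q)) {ι : Type} (s : Finset ι)
    (f : ι → DimDrop p q) (h : ∀ i ∈ s, f i ∈ I) : ∑ i ∈ s, f i ∈ I := by
  classical
  induction s using Finset.induction_on with
  | empty => simpa using I.zero_mem
  | insert a s ha ih =>
    rw [Finset.sum_insert ha]
    exact I.add_mem (h a (by simp)) (ih fun i hi => h i (by simp [hi]))

/-- The element `s ↦ w s • A s`. -/
def mkD {p q : ℕ} (w : C(unitInterval, ℂ))
    (A : C(unitInterval, Matrix (Fin p × Fin q) (Fin p × Fin q) ℂ))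
    (h0 : w 0 = 0 ∨ ∃ x : Matrix (Fin p) (Fin p) ℂ, A 0 = x ⊗ₖ (1 : Matrix (Fin q) (Fin q) ℂ))
    (h1 : w 1 = 0 ∨ ∃ y : Matrix (Fin q) (Fin q) ℂ, A 1 = (1 : Matrix (Fin p) (Fin p) ℂ) ⊗ₖ y) :
    DimDrop p q :=
  ⟨⟨fun s => w s • A s, w.continuous.smul A.continuous⟩, by
    constructor
    · rcases h0 with h | ⟨x, hx⟩
      · exact ⟨0, by simp [h]⟩
      · exact ⟨w 0 • x, by simp [hx, Matrix.smul_kronecker]⟩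
    · rcases h1 with h | ⟨x, hx⟩
      · exact ⟨0, by simp [h]⟩
      · exact ⟨w 1 • x, by simp [hx, Matrix.kronecker_smul]⟩⟩

lemma mkD_apply {p q : ℕ} (w : C(unitInterval, ℂ))
    (A : C(unitInterval, Matrix (Fin p × Fin q) (Fin p × Fin q) ℂ)) (h0) (h1) (s : unitInterval) :
    (mkD w A h0 h1 : DimDrop p q).1 s = w s • A s := rfl

/-- Scalar-valued functions. -/
def sc {p q : ℕ} (w : C(unitInterval, ℂ)) : DimDrop p q :=
  mkD w 1 (.inr ⟨1, by simp⟩) (.inr ⟨1, by simp⟩)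

lemma sc_apply {p q : ℕ} (w : C(unitInterval, ℂ)) (s : unitInterval) :
    (sc w : DimDrop p q).1 s = w s • 1 := rfl

lemma dimDrop_ext {p q : ℕ} {f g : DimDrop p q} (h : ∀ s, f.1 s = g.1 s) : f = g :=
  Subtype.ext (ContinuousMap.ext h)

lemma sc_continuous {p q : ℕ} : Continuous (sc : C(unitInterval, ℂ) → DimDrop p q) := by
  refine Continuous.subtype_mk (f := fun w => ContinuousMap.comp
    (⟨fun c : ℂ => c • (1 : Matrix (Fin p × Fin q) (Fin p × Fin q) ℂ), by fun_prop⟩ :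
      C(ℂ, Matrix (Fin p × Fin q) (Fin p × Fin q) ℂ)) w) ?_ _
  exact ContinuousMap.continuous_postcomp _

/-- The ideal of scalar functions lying in `I`. -/
def scIdeal {p q : ℕ} (I : TwoSidedIdeal (DimDrop p q)) : Ideal C(unitInterval, ℂ) where
  carrier := {w | sc w ∈ I}
  add_mem' {a b} ha hb := by
    have : (sc (a + b) : DimDrop p q) = sc a + sc b :=
      dimDrop_ext fun s => add_smul (a s) (b s) _
    change sc (a + b) ∈ I
    rw [this]; exact I.add_mem ha hb
  zero_mem' := by
    have : (sc 0 : DimDrop p q) = 0 := dimDrop_ext fun s => zero_smul ℂ _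
    change sc 0 ∈ I
    rw [this]; exact I.zero_mem
  smul_mem' a b hb := by
    have : (sc (a * b) : DimDrop p q) = sc a * sc b := dimDrop_ext fun s => by
      change (a s * b s) • (1 : Matrix (Fin p × Fin q) (Fin p × Fin q) ℂ) =
        (a s • (1 : Matrix (Fin p × Fin q) (Fin p × Fin q) ℂ)) * (b s • 1)
      rw [smul_mul_smul_comm, one_mul]
    change sc (a * b) ∈ I
    rw [this]; exact I.mul_mem_left _ _ hb

lemma mem_scIdeal {p q : ℕ} (I : TwoSidedIdeal (DimDrop p q)) (w) :
    w ∈ scIdeal I ↔ sc w ∈ I := Iff.rfl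

lemma scalar_of {p q : ℕ} (I : TwoSidedIdeal (DimDrop p q)) (w : C(unitInterval, ℂ))
    (h : DimDrop p q) (hI : h ∈ I) (t : unitInterval) (c : ℂ) (hc : c ≠ 0)
    (ht : h.1 t = c • 1) (hw : w t ≠ 0)
    (h0 : w 0 = 0 ∨ ∃ c : ℂ, h.1 0 = c • 1) (h1 : w 1 = 0 ∨ ∃ c : ℂ, h.1 1 = c • 1) :
    ∃ d ∈ scIdeal I, d t ≠ 0 := by
  let A : C(unitInterval, Matrix (Fin p × Fin q) (Fin p × Fin q) ℂ) :=
    ⟨fun s => (h.1 s).adjugate, h.1.continuous.matrix_adjugate⟩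
  let b : DimDrop p q := mkD w A
    (h0.imp_right fun ⟨c, hc⟩ => ⟨c ^ (Fintype.card (Fin p × Fin q) - 1) • 1, by
      change (h.1 0).adjugate = _
      rw [hc, Matrix.adjugate_smul, Matrix.adjugate_one, Matrix.smul_kronecker,
        Matrix.one_kronecker_one]⟩)
    (h1.imp_right fun ⟨c, hc⟩ => ⟨c ^ (Fintype.card (Fin p × Fin q) - 1) • 1, by
      change (h.1 1).adjugate = _
      rw [hc, Matrix.adjugate_smul, Matrix.adjugate_one, Matrix.kronecker_smul,
        Matrix.one_kronecker_one]⟩)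
  refine ⟨w * ⟨fun s => (h.1 s).det, h.1.continuous.matrix_det⟩, ?_, ?_⟩
  · rw [mem_scIdeal]
    have : sc (w * ⟨fun s => (h.1 s).det, h.1.continuous.matrix_det⟩) = b * h := by
      apply dimDrop_ext
      intro s
      change (w s * (h.1 s).det) • (1 : Matrix _ _ ℂ) = (w s • (h.1 s).adjugate) * h.1 s
      rw [smul_mul_assoc, Matrix.adjugate_mul, mul_smul]
    rw [this]
    exact I.mul_mem_left _ _ hI
  · change w t * (h.1 t).det ≠ 0
    rw [ht, Matrix.det_smul]
    simp [hw, hc]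

lemma sum_single_mul {n : Type} [Fintype n] [DecidableEq n] (X : Matrix n n ℂ) (k l : n) :
    ∑ i, Matrix.single i k (1 : ℂ) * X * Matrix.single l i (1 : ℂ) = X k l • (1 : Matrix n n ℂ) := by
  simp only [Matrix.single_mul_mul_single, one_mul, mul_one]
  rw [Matrix.sum_single_eq_diagonal, Matrix.smul_one_eq_diagonal]

lemma exists_entry {m n : Type} {X : Matrix m n ℂ} (h : X ≠ 0) : ∃ k l, X k l ≠ 0 := by
  by_contra! hall
  exact h (Matrix.ext hall)

/-- the function `s ↦ s`. -/
def idC : C(unitInterval, ℂ) := ⟨fun s => ((s : ℝ) : ℂ), by fun_prop⟩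

lemma coe_sum_apply {p q : ℕ} {ι : Type} (s : Finset ι) (f : ι → DimDrop p q) (t : unitInterval) :
    (∑ i ∈ s, f i).1 t = ∑ i ∈ s, (f i).1 t := by
  classical
  induction s using Finset.induction_on with
  | empty => rfl
  | insert a s ha ih =>
    rw [Finset.sum_insert ha, Finset.sum_insert ha, ← ih]; rfl

lemma exists_scalar {p q : ℕ} (I : TwoSidedIdeal (DimDrop p q)) (g : DimDrop p q) (hg : g ∈ I)
    (t : unitInterval) (ht : g.1 t ≠ 0) : ∃ d ∈ scIdeal I, d t ≠ 0 := by
  by_cases t0 : t = 0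
  · subst t0
    obtain ⟨x, hx⟩ := g.2.1
    have hx0 : x ≠ 0 := by rintro rfl; exact ht (by rw [hx]; simp)
    obtain ⟨k, l, hkl⟩ := exists_entry hx0
    let a : Fin p → Fin p → DimDrop p q := fun i j =>
      mkD (1 - idC) (.const _ (Matrix.single i j (1 : ℂ) ⊗ₖ 1)) (.inr ⟨_, rfl⟩)
        (.inl (by simp [idC]))
    have key : (∑ i, a i k * g * a l i).1 0 = x k l • 1 := by
      rw [coe_sum_apply]
      have : ∀ i, (a i k * g * a l i).1 0
          = (Matrix.single i k (1 : ℂ) * x * Matrix.single l i (1 : ℂ)) ⊗ₖ 1 := by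
        intro i
        change (a i k).1 0 * g.1 0 * (a l i).1 0 = _
        simp only [a, mkD_apply, hx]
        simp [idC, ← Matrix.mul_kronecker_mul]
      simp only [this]
      rw [← Matrix.one_kronecker_one, ← Matrix.smul_kronecker, ← sum_single_mul]
      ext ⟨i, j⟩ ⟨i', j'⟩
      simp [Matrix.sum_apply, Matrix.kroneckerMap_apply, Finset.sum_mul]
    exact scalar_of I (1 - idC) (∑ i, a i k * g * a l i)
      (dimDrop_sum_mem I _ _ fun i _ => I.mul_mem_right _ _ (I.mul_mem_left _ _ hg)) 0 _ hkl
      key (by simp [idC]) (.inr ⟨_, key⟩) (.inl (by simp [idC]))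
  by_cases t1 : t = 1
  · subst t1
    obtain ⟨x, hx⟩ := g.2.2
    have hx0 : x ≠ 0 := by rintro rfl; exact ht (by rw [hx]; simp)
    obtain ⟨k, l, hkl⟩ := exists_entry hx0
    let a : Fin q → Fin q → DimDrop p q := fun i j =>
      mkD idC (.const _ (1 ⊗ₖ Matrix.single i j (1 : ℂ))) (.inl (by simp [idC])) (.inr ⟨_, rfl⟩)
    have key : (∑ i, a i k * g * a l i).1 1 = x k l • 1 := by
      rw [coe_sum_apply]
      have : ∀ i, (a i k * g * a l i).1 1
          = 1 ⊗ₖ (Matrix.single i k (1 : ℂ) * x * Matrix.single l i (1 : ℂ)) := by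
        intro i
        change (a i k).1 1 * g.1 1 * (a l i).1 1 = _
        simp only [a, mkD_apply, hx]
        simp [idC, ← Matrix.mul_kronecker_mul]
      simp only [this]
      rw [← Matrix.one_kronecker_one, ← Matrix.kronecker_smul, ← sum_single_mul]
      ext ⟨i, j⟩ ⟨i', j'⟩
      simp [Matrix.sum_apply, Matrix.kroneckerMap_apply, Finset.mul_sum]
    exact scalar_of I idC (∑ i, a i k * g * a l i)
      (dimDrop_sum_mem I _ _ fun i _ => I.mul_mem_right _ _ (I.mul_mem_left _ _ hg)) 1 _ hkl
      key (by simp [idC]) (.inl (by simp [idC])) (.inr ⟨_, key⟩)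
  · obtain ⟨k, l, hkl⟩ := exists_entry ht
    let w : C(unitInterval, ℂ) := idC * (1 - idC)
    have w0 : w 0 = 0 := by simp [w, idC]
    have w1 : w 1 = 0 := by simp [w, idC]
    have wt : w t ≠ 0 := by
      change ((t : ℝ) : ℂ) * (1 - ((t : ℝ) : ℂ)) ≠ 0
      refine mul_ne_zero ?_ (sub_ne_zero.2 ?_)
      · exact_mod_cast fun h => t0 (Subtype.ext h)
      · exact_mod_cast fun h => t1 (Subtype.ext (Eq.symm h))
    let a : Fin p × Fin q → Fin p × Fin q → DimDrop p q := fun i j =>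
      mkD w (.const _ (Matrix.single i j (1 : ℂ))) (.inl w0) (.inl w1)
    have key : (∑ i, a i k * g * a l i).1 t = (w t * w t * g.1 t k l) • 1 := by
      rw [coe_sum_apply]
      have : ∀ i, (a i k * g * a l i).1 t
          = (w t * w t) • (Matrix.single i k (1 : ℂ) * g.1 t * Matrix.single l i (1 : ℂ)) := by
        intro i
        change (a i k).1 t * g.1 t * (a l i).1 t = _
        simp only [a, mkD_apply, ContinuousMap.const_apply, smul_mul_assoc, mul_smul_comm, mul_smul]
      simp only [this]
      rw [← Finset.smul_sum, sum_single_mul, mul_smul _ (g.1 t k l)]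
    exact scalar_of I w (∑ i, a i k * g * a l i)
      (dimDrop_sum_mem I _ _ fun i _ => I.mul_mem_right _ _ (I.mul_mem_left _ _ hg)) t _
      (mul_ne_zero (mul_ne_zero wt wt) hkl) key wt (.inl w0) (.inl w1)

/-- truncation to `[0,1]`, complex valued -/
def clampC (u : C(unitInterval, ℝ)) : C(unitInterval, ℂ) :=
  ⟨fun s => ((max 0 (min 1 (u s)) : ℝ) : ℂ), by fun_prop⟩

lemma clampC_one {u : C(unitInterval, ℝ)} {s} (h : 1 ≤ u s) : clampC u s = 1 := by
  change ((max 0 (min 1 (u s)) : ℝ) : ℂ) = 1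
  rw [min_eq_left h]; simp

lemma clampC_zero {u : C(unitInterval, ℝ)} {s} (h : u s ≤ 0) : clampC u s = 0 := by
  change ((max 0 (min 1 (u s)) : ℝ) : ℂ) = 0
  rw [max_eq_left ((min_le_right _ _).trans h)]; simp

lemma star_clampC (u : C(unitInterval, ℝ)) (s) : star (clampC u s) = clampC u s :=
  Complex.conj_ofReal _

/-- Let `p, q ≥ 2` be relatively prime and let `I` be a proper nonzero closed two-sided ideal
of the dimension-drop algebra `Z_{p,q}`.  Then the quotient `Z_{p,q}/I` contains a projection
different from `0` and `1`; equivalently (on the level of representatives), there is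
`e ∈ Z_{p,q}` which is selfadjoint and idempotent modulo `I` and with `e ∉ I` and
`1 - e ∉ I`. -/
theorem quotient_dimDrop_has_nontrivial_projection (p q : ℕ) (hp : 2 ≤ p) (hq : 2 ≤ q)
    (hpq : Nat.Coprime p q) (I : TwoSidedIdeal (DimDrop p q))
    (hclosed : IsClosed (I : Set (DimDrop p q)))
    (hne_bot : ∃ x : DimDrop p q, x ∈ I ∧ x ≠ 0)
    (hne_top : ∃ x : DimDrop p q, x ∉ I) :
    ∃ e : DimDrop p q, star e - e ∈ I ∧ e * e - e ∈ I ∧ e ∉ I ∧ (1 : DimDrop p q) - e ∉ I := by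
  have hcl : IsClosed (scIdeal I : Set C(unitInterval, ℂ)) := hclosed.preimage sc_continuous
  have hS := ContinuousMap.idealOfSet_ofIdeal_isClosed hcl
  have hmem : ∀ w : C(unitInterval, ℂ),
      (∀ t, (∀ d ∈ scIdeal I, d t = 0) → w t = 0) → sc w ∈ I := by
    intro w hw
    rw [← mem_scIdeal, ← hS, ContinuousMap.mem_idealOfSet]
    intro t ht
    exact hw t (ContinuousMap.notMem_setOfIdeal.1 ht)
  have hzero : ∀ g ∈ I, ∀ t, (∀ d ∈ scIdeal I, d t = 0) → g.1 t = 0 := by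
    intro g hg t ht
    by_contra h
    obtain ⟨d, hd, hdt⟩ := exists_scalar I g hg t h
    exact hdt (ht d hd)
  obtain ⟨r, hr⟩ : ∃ r, ∀ d ∈ scIdeal I, d r = 0 := by
    by_contra! h
    obtain ⟨x, hx⟩ := hne_top
    apply hx
    have h1 : (sc 1 : DimDrop p q) ∈ I := hmem 1 fun t ht => by
      obtain ⟨d, hd, hdt⟩ := h t
      exact absurd (ht d hd) hdt
    have : x = x * sc 1 := dimDrop_ext fun s => by
      change x.1 s = x.1 s * ((1 : ℂ) • 1)
      simp
    rw [this]
    exact I.mul_mem_left _ _ h1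
  obtain ⟨x, hxI, hx0⟩ := hne_bot
  obtain ⟨t₀, ht₀⟩ : ∃ t, x.1 t ≠ 0 := by
    by_contra! h
    exact hx0 (dimDrop_ext h)
  obtain ⟨d, hd, hdt⟩ := exists_scalar I x hxI t₀ ht₀
  obtain ⟨δ, hδ, hball⟩ := Metric.isOpen_iff.1
    (isOpen_ne.preimage d.continuous : IsOpen (d ⁻¹' {z | z ≠ 0})) t₀ hdt
  have hF : ∀ t, (∀ d ∈ scIdeal I, d t = 0) → δ ≤ |(t : ℝ) - t₀| := by
    intro t ht
    by_contra! h
    exact hball (show dist t t₀ < δ from h) (ht d hd)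
  let u : C(unitInterval, ℝ) := ⟨fun s => 2 / δ * (t₀ - s), by fun_prop⟩
  let v : C(unitInterval, ℝ) := ⟨fun s => 2 / δ * (s - t₀), by fun_prop⟩
  let y : C(unitInterval, ℝ) := ⟨fun s => 2 - 2 / δ * |(s : ℝ) - t₀|, by fun_prop⟩
  have hpos : 0 < 2 / δ := by positivity
  have hδ1 : 2 / δ * (δ / 2) = 1 := by field_simp
  have hδ2 : 2 / δ * δ = 2 := by field_simp
  let i₀ : Fin p := ⟨0, by omega⟩
  let i₁ : Fin p := ⟨1, by omega⟩
  let j₀ : Fin q := ⟨0, by omega⟩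
  let j₁ : Fin q := ⟨1, by omega⟩
  let P : Matrix (Fin p × Fin q) (Fin p × Fin q) ℂ := Matrix.single i₀ i₀ (1 : ℂ) ⊗ₖ 1
  let Q : Matrix (Fin p × Fin q) (Fin p × Fin q) ℂ := 1 ⊗ₖ Matrix.single j₀ j₀ (1 : ℂ)
  have hPs : star P = P := by
    simp only [P, star_kronecker, star_one]
    rw [Matrix.star_eq_conjTranspose, Matrix.conjTranspose_single, star_one]
  have hQs : star Q = Q := by
    simp only [Q, star_kronecker, star_one]
    rw [Matrix.star_eq_conjTranspose, Matrix.conjTranspose_single, star_one]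
  have hPP : P * P = P := by simp [P, ← Matrix.mul_kronecker_mul]
  have hQQ : Q * Q = Q := by simp [Q, ← Matrix.mul_kronecker_mul]
  have hP00 : P (i₀, j₀) (i₀, j₀) = 1 := by simp [P, Matrix.kroneckerMap_apply]
  have hQ00 : Q (i₀, j₀) (i₀, j₀) = 1 := by simp [Q, Matrix.kroneckerMap_apply]
  have hP11 : P (i₁, j₁) (i₁, j₁) = 0 := by
    simp [P, Matrix.kroneckerMap_apply, Matrix.single_apply, i₀, i₁]
  have hQ11 : Q (i₁, j₁) (i₁, j₁) = 0 := by
    simp [Q, Matrix.kroneckerMap_apply, Matrix.single_apply, j₀, j₁]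
  have hu1 : clampC u 1 = 0 := clampC_zero (by
    change 2 / δ * ((t₀ : ℝ) - 1) ≤ 0
    have := t₀.2.2
    exact mul_nonpos_of_nonneg_of_nonpos hpos.le (by linarith))
  have hv0 : clampC v 0 = 0 := clampC_zero (by
    change 2 / δ * (0 - (t₀ : ℝ)) ≤ 0
    have := t₀.2.1
    exact mul_nonpos_of_nonneg_of_nonpos hpos.le (by linarith))
  let e : DimDrop p q := mkD (clampC u) (.const _ P) (.inr ⟨_, rfl⟩) (.inl hu1)
    + mkD (clampC v) (.const _ Q) (.inl hv0) (.inr ⟨_, rfl⟩)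
  have he : ∀ s, e.1 s = clampC u s • P + clampC v s • Q := fun s => rfl
  have hePQ : ∀ s : unitInterval, δ / 2 ≤ |(s : ℝ) - t₀| → e.1 s = P ∨ e.1 s = Q := by
    intro s hs
    rcases le_abs.1 hs with h | h
    · right
      have h1 : clampC v s = 1 := clampC_one (by
        change 1 ≤ 2 / δ * ((s : ℝ) - t₀)
        nlinarith)
      have h2 : clampC u s = 0 := clampC_zero (by
        change 2 / δ * ((t₀ : ℝ) - s) ≤ 0
        nlinarith)
      rw [he, h1, h2]; simp
    · left
      have h1 : clampC u s = 1 := clampC_one (by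
        change 1 ≤ 2 / δ * ((t₀ : ℝ) - s)
        nlinarith)
      have h2 : clampC v s = 0 := clampC_zero (by
        change 2 / δ * ((s : ℝ) - t₀) ≤ 0
        nlinarith)
      rw [he, h1, h2]; simp
  have hr' := hePQ r (by have := hF r hr; linarith)
  refine ⟨e, ?_, ?_, ?_, ?_⟩
  · have : star e - e = 0 := dimDrop_ext fun s => by
      change star (e.1 s) - e.1 s = 0
      rw [he, star_add, star_smul, star_smul, star_clampC, star_clampC, hPs, hQs, sub_self]
    rw [this]
    exact I.zero_mem
  · have : e * e - e = sc (clampC y) * (e * e - e) := dimDrop_ext fun s => by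
      change e.1 s * e.1 s - e.1 s = (clampC y s • 1) * (e.1 s * e.1 s - e.1 s)
      rcases le_total (δ / 2) |(s : ℝ) - t₀| with h | h
      · have : e.1 s * e.1 s - e.1 s = 0 := by
          rcases hePQ s h with h | h
          · rw [h, hPP, sub_self]
          · rw [h, hQQ, sub_self]
        rw [this, mul_zero]
      · have h1 : clampC y s = 1 := clampC_one (by
          change 1 ≤ 2 - 2 / δ * |(s : ℝ) - t₀|
          nlinarith)
        rw [h1, one_smul, one_mul]
    rw [this]
    refine I.mul_mem_right _ _ (hmem _ fun t ht => clampC_zero ?_)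
    change 2 - 2 / δ * |(t : ℝ) - t₀| ≤ 0
    have := hF t ht
    nlinarith
  · intro h
    have h1 := congrFun (congrFun (hzero e h r hr) (i₀, j₀)) (i₀, j₀)
    rcases hr' with h | h
    · rw [h, hP00] at h1; simp at h1
    · rw [h, hQ00] at h1; simp at h1
  · intro h
    have h1 : 1 - e.1 r = 0 := hzero _ h r hr
    have h2 := congrFun (congrFun h1 (i₁, j₁)) (i₁, j₁)
    rw [Matrix.sub_apply] at h2
    rcases hr' with h | h
    · rw [h, hP11] at h2; simp at h2
    · rw [h, hQ11] at h2; simp at h2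
end
end
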